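/- Let c > 0, δ > 0 and τ₀ ∈ ℝ. There is no differentiable function f : [τ₀, τ₀ + c/δ] → ℝ satisfying f(τ₀) ≤ −δ and f'(τ) ≤ −f(τ)²/c for all τ ∈ [τ₀, τ₀ + c/δ]. -/

import Mathlib

/-- Riccati blow-up: there is no differentiable function on the closed
interval `[τ₀, τ₀ + c/δ]` with `f(τ₀) ≤ −δ` satisfying the Riccati
differential inequality `f' ≤ −f²/c`. -/
theorem riccati_blowup (c δ τ₀ : ℝ) (hc : 0 < c) (hδ : 0 < δ) :
    ¬ ∃ f f' : ℝ → ℝ,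
      (∀ τ ∈ Set.Icc τ₀ (τ₀ + c / δ),
        HasDerivWithinAt f (f' τ) (Set.Icc τ₀ (τ₀ + c / δ)) τ) ∧
      f τ₀ ≤ -δ ∧
      (∀ τ ∈ Set.Icc τ₀ (τ₀ + c / δ), f' τ ≤ -(f τ) ^ 2 / c) := by
  rintro ⟨f, f', hf, h₀, hle⟩
  have hlen : τ₀ ≤ τ₀ + c / δ := le_add_of_nonneg_right (by positivity)
  have hanti : AntitoneOn f (Set.Icc τ₀ (τ₀ + c / δ)) := by
    refine antitoneOn_of_hasDerivWithinAt_nonpos (f' := f') (convex_Icc _ _)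
      (fun τ hτ => (hf τ hτ).continuousWithinAt)
      (fun τ hτ => (hf τ (interior_subset hτ)).mono interior_subset) fun τ hτ => ?_
    refine (hle τ (interior_subset hτ)).trans ?_
    exact div_nonpos_of_nonpos_of_nonneg (neg_nonpos.2 (sq_nonneg _)) hc.le
  have hneg : ∀ τ ∈ Set.Icc τ₀ (τ₀ + c / δ), f τ < 0 := fun τ hτ => by
    linarith [hanti (Set.left_mem_Icc.2 hlen) hτ hτ.1]
  have hderiv : ∀ τ ∈ Set.Icc τ₀ (τ₀ + c / δ),
      HasDerivWithinAt (fun t => (f t)⁻¹ - t / c) (-f' τ / f τ ^ 2 - 1 / c)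
        (Set.Icc τ₀ (τ₀ + c / δ)) τ := fun τ hτ =>
    ((hf τ hτ).fun_inv (hneg τ hτ).ne).fun_sub ((hasDerivWithinAt_id τ _).div_const c)
  have hmono : MonotoneOn (fun t => (f t)⁻¹ - t / c) (Set.Icc τ₀ (τ₀ + c / δ)) := by
    refine monotoneOn_of_hasDerivWithinAt_nonneg (convex_Icc _ _)
      (fun τ hτ => (hderiv τ hτ).continuousWithinAt)
      (fun τ hτ => (hderiv τ (interior_subset hτ)).mono interior_subset) fun τ hτ => ?_
    have hsq : 0 < f τ ^ 2 := sq_pos_of_neg (hneg τ (interior_subset hτ))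
    have hτ' := hle τ (interior_subset hτ)
    rw [sub_nonneg, le_div_iff₀ hsq]
    rw [neg_div] at hτ'
    rw [one_div_mul_eq_div]
    linarith
  have hends := hmono (Set.left_mem_Icc.2 hlen) (Set.right_mem_Icc.2 hlen) hlen
  have hend : (f (τ₀ + c / δ))⁻¹ < 0 := inv_lt_zero.2 (hneg _ (Set.right_mem_Icc.2 hlen))
  have hstart : -δ⁻¹ ≤ (f τ₀)⁻¹ := by
    rw [← inv_neg]
    exact (inv_le_inv_of_neg (by linarith) (hneg _ (Set.left_mem_Icc.2 hlen))).2 h₀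
  have hlength : (τ₀ + c / δ) / c = τ₀ / c + δ⁻¹ := by field_simp
  simp only [hlength] at hends
  linarith
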